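/- Let G be a primitive strongly regular graph with parameters (v,k,λ,μ) whose adjacency matrix (over ℝ) is A, and suppose 2(λ+μ) = 4k − v. Let B = J − I − 2A be the Seidel adjacency matrix of G. Then (B + (2k − v + 1)·I)·(B + (2k + 1 − 4μ)·I) = 0; in other words, B has exactly the two eigenvalues −1−2θ₁ and −1−2θ₂ (with {θ₁,θ₂} = {k − v/2, k − 2μ}), so that G belongs to the switching class of a regular two-graph. -/

import Mathlib

open Finset SimpleGraph Matrix

theorem SimpleGraph.IsRegularOfDegree.adjMatrix_mul_allOnes
    {V : Type*} [Fintype V] {G : SimpleGraph V} [DecidableRel G.Adj] {k : ℕ}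
    (h : G.IsRegularOfDegree k) :
    G.adjMatrix ℝ * Matrix.of (fun _ _ => (1 : ℝ)) = (k : ℝ) • Matrix.of (fun _ _ => (1 : ℝ)) := by
  ext i j
  simp [h.degree_eq i]

theorem SimpleGraph.IsRegularOfDegree.allOnes_mul_adjMatrix
    {V : Type*} [Fintype V] {G : SimpleGraph V} [DecidableRel G.Adj] {k : ℕ}
    (h : G.IsRegularOfDegree k) :
    Matrix.of (fun _ _ => (1 : ℝ)) * G.adjMatrix ℝ = (k : ℝ) • Matrix.of (fun _ _ => (1 : ℝ)) := by
  ext i j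
  simp [h.degree_eq j]

theorem Matrix.allOnes_mul_allOnes {V : Type*} [Fintype V] :
    (Matrix.of (fun _ _ => (1 : ℝ)) : Matrix V V ℝ) * Matrix.of (fun _ _ => (1 : ℝ)) =
      (Fintype.card V : ℝ) • Matrix.of (fun _ _ => (1 : ℝ)) := by
  ext i j
  simp [Matrix.mul_apply]

theorem SimpleGraph.IsSRGWith.adjMatrix_mul_self
    {V : Type*} [Fintype V] [DecidableEq V] {G : SimpleGraph V} [DecidableRel G.Adj]
    {v k l m : ℕ} (h : G.IsSRGWith v k l m) :
    G.adjMatrix ℝ * G.adjMatrix ℝ = ((k : ℝ) - m) • (1 : Matrix V V ℝ) +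
      ((l : ℝ) - m) • G.adjMatrix ℝ + (m : ℝ) • Matrix.of (fun _ _ => (1 : ℝ)) := by
  rw [← pow_two, h.matrix_eq]
  simp only [← Nat.cast_smul_eq_nsmul ℝ]
  ext i j
  by_cases hij : i = j
  · subst hij
    simp
  · by_cases ha : G.Adj i j <;> simp [hij, ha]

/-- Counting walks of length two from a vertex, over `ℝ` so that no subtraction truncates. -/
theorem SimpleGraph.IsSRGWith.real_param_eq
    {V : Type*} [Fintype V] [DecidableEq V] [Nonempty V] {G : SimpleGraph V} [DecidableRel G.Adj]
    {v k l m : ℕ} (h : G.IsSRGWith v k l m) :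
    (k : ℝ) * k = (k - m) + (l - m) * k + m * v := by
  have key := congrArg (· * (Matrix.of (fun _ _ => (1 : ℝ)) : Matrix V V ℝ)) h.adjMatrix_mul_self
  simp only [Matrix.mul_assoc, h.regular.adjMatrix_mul_allOnes, Matrix.add_mul, Matrix.smul_mul,
    Matrix.mul_smul, Matrix.one_mul, Matrix.allOnes_mul_allOnes, h.card] at key
  obtain ⟨i⟩ := ‹Nonempty V›
  simpa using congrFun (congrFun key i) i

attribute [local instance] Classical.propDecidable

theorem seidel_two_eigenvalues
    {V : Type*} [Fintype V] [DecidableEq V] (G : SimpleGraph V)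
    (v k l m : ℕ) (hsrg : G.IsSRGWith v k l m)
    (hprim : G.Connected ∧ Gᶜ.Connected)
    (hcond : 2 * (l + m) + v = 4 * k) :
    ((Matrix.of (fun _ _ => (1 : ℝ)) - 1 - 2 • G.adjMatrix ℝ) +
        (2 * (k : ℝ) - v + 1) • (1 : Matrix V V ℝ)) *
      ((Matrix.of (fun _ _ => (1 : ℝ)) - 1 - 2 • G.adjMatrix ℝ) +
        (2 * (k : ℝ) + 1 - 4 * m) • (1 : Matrix V V ℝ)) = 0 := by
  have : Nonempty V := hprim.1.nonempty
  have hparam := hsrg.real_param_eq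
  have hc : 2 * ((l : ℝ) + m) + v = 4 * k := by exact_mod_cast hcond
  have hv : (v : ℝ) = 4 * k - 2 * (l + m) := by linarith
  have hAJ := hsrg.regular.adjMatrix_mul_allOnes
  have hJA := hsrg.regular.allOnes_mul_adjMatrix
  have hJJ := Matrix.allOnes_mul_allOnes (V := V)
  have hAA := hsrg.adjMatrix_mul_self
  rw [hsrg.card] at hJJ
  generalize (Matrix.of (fun _ _ => (1 : ℝ)) : Matrix V V ℝ) = J at *
  generalize G.adjMatrix ℝ = A at *
  simp only [two_nsmul, Matrix.add_mul, Matrix.sub_mul, Matrix.mul_add, Matrix.mul_sub,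
    Matrix.smul_mul, Matrix.mul_smul, Matrix.one_mul, Matrix.mul_one, hAJ, hJA, hJJ, hAA]
  rw [hv] at hparam ⊢
  match_scalars <;> linarith
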